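/- arXiv:2102.00739 — 2 statements merged into one kernel-verified Lean document; each statement's English description precedes it below -/
import Mathlib

section
/- Let N be an even positive integer and k an integer with 0 ≤ k ≤ N/2, and set p_u = k/N. Then for every nonnegative integer n̄, the probability that a uniformly random grouping of [k,N] produces strictly fewer than n̄ wb-pairs satisfies ε(n̄ | [k,N]) ≤ 2 ξ_L(n̄ + 1; 2 p_u (1 − p_u), N/2). (Paper's Result 4.1.) -/
/-- Number of wb-pairs (pairs with exactly one white ball): positions are grouped into
the pairs `{2i, 2i+1}`; the ball at position `j` is white iff `σ j < k`. A uniformly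
random permutation `σ` of the `N` positions realizes a uniformly random grouping
(perfect matching) of a set of `k` white and `N - k` black balls. -/
def wbCount (N k : ℕ) (σ : Equiv.Perm (Fin N)) : ℕ :=
  (Finset.univ.filter fun i : Fin (N / 2) =>
    ((σ ⟨2 * i.1, by have := i.isLt; omega⟩).1 < k ∧
      ¬ (σ ⟨2 * i.1 + 1, by have := i.isLt; omega⟩).1 < k) ∨
    (¬ (σ ⟨2 * i.1, by have := i.isLt; omega⟩).1 < k ∧
      (σ ⟨2 * i.1 + 1, by have := i.isLt; omega⟩).1 < k)).card

/-- ε(n̄ | [k,N]): the probability that a uniformly random grouping of `[k,N]`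
produces strictly fewer than `n̄` wb-pairs. -/
noncomputable def epsWB (N k nbar : ℕ) : ℝ :=
  (Finset.univ.filter fun σ : Equiv.Perm (Fin N) => wbCount N k σ < nbar).card /
    (Fintype.card (Equiv.Perm (Fin N)))


namespace WB
open Finset

/-- number of white balls -/
def wc {N : ℕ} (f : Fin N → Bool) : ℕ := (univ.filter fun j => f j = true).card

def lo {N : ℕ} (i : Fin (N / 2)) : Fin N := ⟨2 * i.1, by have := i.isLt; omega⟩
def hi {N : ℕ} (i : Fin (N / 2)) : Fin N := ⟨2 * i.1 + 1, by have := i.isLt; omega⟩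

def wb {N : ℕ} (f : Fin N → Bool) : ℕ := (univ.filter fun i : Fin (N / 2) => f (lo i) ≠ f (hi i)).card

def col (N k : ℕ) : Fin N → Bool := fun j => decide (j.1 < k)

lemma wbCount_eq (N k : ℕ) (σ : Equiv.Perm (Fin N)) : wbCount N k σ = wb (col N k ∘ σ) := by
  unfold wbCount wb
  congr 1
  ext i
  rw [mem_filter, mem_filter]
  simp only [mem_univ, true_and, col, Function.comp, lo, hi, ne_eq]
  by_cases h1 : (σ ⟨2 * i.1, by have := i.isLt; omega⟩).1 < k <;>
    by_cases h2 : (σ ⟨2 * i.1 + 1, by have := i.isLt; omega⟩).1 < k <;> simp [h1, h2]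

def posEquiv (N : ℕ) (hN : Even N) : Fin (N / 2) × Bool ≃ Fin N where
  toFun x := if x.2 then hi x.1 else lo x.1
  invFun j := (⟨j.1 / 2, by have := j.isLt; obtain ⟨m, rfl⟩ := hN; omega⟩, decide (j.1 % 2 = 1))
  left_inv := by
    rintro ⟨i, b⟩
    cases b <;> simp [lo, hi, Fin.ext_iff] <;> omega
  right_inv := by
    intro j
    by_cases h : j.1 % 2 = 1 <;> simp [h, lo, hi, Fin.ext_iff] <;> omega

def colEquiv (N : ℕ) (hN : Even N) : (Fin N → Bool) ≃ (Fin (N / 2) → Bool × Bool) where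
  toFun f i := (f (lo i), f (hi i))
  invFun c j := let x := (posEquiv N hN).symm j; if x.2 then (c x.1).2 else (c x.1).1
  left_inv := by
    intro f
    funext j
    obtain ⟨⟨i, b⟩, rfl⟩ := (posEquiv N hN).surjective j
    simp only [Equiv.symm_apply_apply]
    cases b <;> simp [posEquiv]
  right_inv := by
    intro c
    funext i
    have h1 : (posEquiv N hN).symm (lo i) = (i, false) := by
      rw [Equiv.symm_apply_eq]; simp [posEquiv]
    have h2 : (posEquiv N hN).symm (hi i) = (i, true) := by
      rw [Equiv.symm_apply_eq]; simp [posEquiv]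
    simp [h1, h2]

lemma prod_pos {R : Type*} [CommSemiring R] (N : ℕ) (hN : Even N) (g : Fin N → R) :
    ∏ j, g j = ∏ i : Fin (N / 2), (g (lo i) * g (hi i)) := by
  rw [← (posEquiv N hN).prod_comp, Fintype.prod_prod_type]
  refine prod_congr rfl fun i _ => ?_
  simp [posEquiv, mul_comm]

def wt {R : Type*} [CommSemiring R] (x z y : R) (c : Bool × Bool) : R :=
  (if c.1 = true then x else z) * (if c.2 = true then x else z) * (if c.1 ≠ c.2 then y else 1)

lemma genfun {R : Type*} [CommSemiring R] (N : ℕ) (hN : Even N) (x z y : R) :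
    ∑ f : Fin N → Bool, (x ^ wc f * z ^ (N - wc f)) * y ^ wb f
      = ((z ^ 2 + x ^ 2) + 2 * x * z * y) ^ (N / 2) := by
  have key : ∀ f : Fin N → Bool, (x ^ wc f * z ^ (N - wc f)) * y ^ wb f =
      ∏ i : Fin (N / 2), wt x z y (colEquiv N hN f i) := by
    intro f
    have h1 := prod_pos N hN (fun j => if f j = true then x else z)
    have h3 : ∏ i : Fin (N / 2), wt x z y (colEquiv N hN f i) =
      (∏ i : Fin (N / 2), ((if f (lo i) = true then x else z) * (if f (hi i) = true then x else z))) *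
       ∏ i : Fin (N / 2), (if f (lo i) ≠ f (hi i) then y else 1) := by
      rw [← prod_mul_distrib]
      rfl
    rw [h3, ← h1, prod_ite, prod_ite]
    simp only [prod_const, one_pow, mul_one]
    have h2 : (univ.filter fun j => ¬ f j = true).card = N - wc f := by
      have := card_filter_add_card_filter_not (s := (univ : Finset (Fin N))) (fun j => f j = true)
      simp only [card_univ, Fintype.card_fin] at this
      unfold wc
      omega
    rw [h2]
    rfl
  rw [sum_congr rfl fun f _ => key f]
  rw [(colEquiv N hN).sum_comp (fun c => ∏ i, wt x z y (c i)), ← Fintype.sum_pow]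
  congr 1
  simp [Fintype.sum_prod_type, wt]
  ring

def cnt (N k j : ℕ) : ℕ := (univ.filter fun f : Fin N → Bool => wc f = k ∧ wb f = j).card

lemma cnt_eq (N : ℕ) (hN : Even N) (k j : ℕ) :
    cnt N k j = (N / 2).choose j * 2 ^ j *
      (if j ≤ k ∧ 2 ∣ (k - j) then (N / 2 - j).choose ((k - j) / 2) else 0) := by
  open Polynomial in
  have h := genfun (R := ℕ[X][X]) N hN (C X) 1 X
  open Polynomial in
  have h2 := congrArg (fun P : ℕ[X][X] => (P.coeff j).coeff k) h
  simp only [one_pow, mul_one] at h2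
  open Polynomial in
  have e1 : ((∑ f : Fin N → Bool, (C X : ℕ[X][X]) ^ wc f * X ^ wb f).coeff j).coeff k = cnt N k j := by
    rw [finsetSum_coeff, finsetSum_coeff]
    unfold cnt
    rw [card_filter]
    refine sum_congr rfl fun f _ => ?_
    rw [← C_pow, coeff_C_mul, coeff_X_pow]
    by_cases hj : wb f = j
    · simp [hj, coeff_X_pow, eq_comm]
    · have : ¬ j = wb f := fun h => hj h.symm
      simp [hj, this]
  open Polynomial in
  have e2 : (((1 + (C X : ℕ[X][X]) ^ 2 + 2 * C X * X) ^ (N / 2)).coeff j) =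
      C ((N/2).choose j * 2 ^ j) * (X ^ j * expand ℕ 2 ((1 + X) ^ (N / 2 - j))) := by
    have : (1 + (C X : ℕ[X][X]) ^ 2 + 2 * C X * X) = C (2 * X) * X + C (1 + X ^ 2) := by
      have h2 : (C (2 : ℕ[X]) : ℕ[X][X]) = 2 := rfl
      simp [h2]; ring
    rw [this, add_pow (C (2 * X) * X : ℕ[X][X]), finsetSum_coeff]
    have : ∀ m ∈ range (N/2 + 1), (((C (2 * X) * X : ℕ[X][X]) ^ m * C (1 + X ^ 2) ^ (N / 2 - m) * ((N / 2).choose m : ℕ[X][X])).coeff j) =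
       if j = m then (2 * X) ^ m * (1 + X ^ 2) ^ (N / 2 - m) * ((N / 2).choose m : ℕ[X]) else 0 := by
      intro m _
      have : ((C (2 * X) * X : ℕ[X][X]) ^ m * C (1 + X ^ 2) ^ (N / 2 - m) * ((N / 2).choose m : ℕ[X][X])) = C ((2 * X) ^ m * (1 + X ^ 2) ^ (N / 2 - m) * ((N / 2).choose m : ℕ[X])) * X ^ m := by
        simp only [C_mul, C_pow, C_add, map_natCast, mul_pow]; ring
      rw [this, coeff_C_mul, coeff_X_pow]
      simp
    rw [sum_congr rfl this, sum_ite_eq]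
    split_ifs with hj
    · simp [mul_pow]; ring
    · have : (N/2).choose j = 0 := Nat.choose_eq_zero_of_lt (by simpa using hj)
      simp [this]
  rw [e1, e2] at h2
  rw [h2]
  open Polynomial in
  rw [coeff_C_mul, coeff_X_pow_mul', coeff_expand (by norm_num)]
  congr 1
  by_cases h1 : j ≤ k <;> by_cases h3 : 2 ∣ k - j <;> simp [h1, h3, Polynomial.coeff_one_add_X_pow]

lemma mlr (N : ℕ) (hN : Even N) (k : ℕ) (hk : k + 1 ≤ N / 2) (j j' : ℕ) (hj : j ≤ j') :
    cnt N (k + 2) j * cnt N k j' ≤ cnt N (k + 2) j' * cnt N k j := by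
  simp only [cnt_eq N hN]
  set M := N / 2
  by_cases h1 : j' ≤ k ∧ 2 ∣ k - j'
  swap
  · rw [if_neg h1]; simp
  by_cases h2 : j ≤ k + 2 ∧ 2 ∣ k + 2 - j
  swap
  · rw [if_neg h2]; simp
  obtain ⟨h1, b, hb⟩ := h1
  obtain ⟨h2, c, hc⟩ := h2
  obtain ⟨d, rfl⟩ : ∃ d, j' = j + 2 * d := ⟨c - 1 - b, by omega⟩
  obtain ⟨t, ht⟩ : ∃ t, M = j + 2 * d + b + t := ⟨M - (j + 2 * d + b), by omega⟩
  rw [if_pos ⟨h2, c, hc⟩, if_pos ⟨h1, b, hb⟩, if_pos ⟨by omega, b + 1, by omega⟩, if_pos ⟨by omega, b + d, by omega⟩]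
  rw [show (k + 2 - j) / 2 = b + d + 1 by omega, show (k - (j + 2 * d)) / 2 = b by omega,
    show (k + 2 - (j + 2 * d)) / 2 = b + 1 by omega, show (k - j) / 2 = b + d by omega,
    show M - j = b + t + 2 * d by omega, show M - (j + 2 * d) = b + t by omega]
  have e1 := Nat.choose_succ_right_eq (b + t + 2 * d) (b + d)
  have e2 := Nat.choose_succ_right_eq (b + t) b
  rw [show b + t + 2 * d - (b + d) = t + d by omega] at e1
  rw [show b + t - b = t by omega] at e2
  have htb : b + 1 ≤ t := by omega
  have key : (b + t + 2 * d).choose (b + d + 1) * (b + t).choose b ≤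
      (b + t).choose (b + 1) * (b + t + 2 * d).choose (b + d) := by
    generalize (b + t + 2 * d).choose (b + d + 1) = A1 at *
    generalize (b + t + 2 * d).choose (b + d) = A0 at *
    generalize (b + t).choose (b + 1) = B1 at *
    generalize (b + t).choose b = B0 at *
    have h : (A1 * B0) * ((b + d + 1) * (b + 1)) ≤ (B1 * A0) * ((b + d + 1) * (b + 1)) := by
      calc (A1 * B0) * ((b + d + 1) * (b + 1)) = (A1 * (b + d + 1)) * B0 * (b + 1) := by ring
        _ = A0 * B0 * ((t + d) * (b + 1)) := by rw [e1]; ring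
        _ ≤ A0 * B0 * (t * (b + d + 1)) := by
          apply Nat.mul_le_mul_left; nlinarith
        _ = (B0 * t) * A0 * (b + d + 1) := by ring
        _ = (B1 * A0) * ((b + d + 1) * (b + 1)) := by rw [← e2]; ring
    exact Nat.le_of_mul_le_mul_right h (by positivity)
  calc _ = (M.choose j * 2 ^ j * (M.choose (j + 2 * d) * 2 ^ (j + 2 * d))) * ((b + t + 2 * d).choose (b + d + 1) * (b + t).choose b) := by ring
    _ ≤ (M.choose j * 2 ^ j * (M.choose (j + 2 * d) * 2 ^ (j + 2 * d))) * ((b + t).choose (b + 1) * (b + t + 2 * d).choose (b + d)) := Nat.mul_le_mul_left _ key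
    _ = _ := by ring

/-! median -/

lemma artanh_ineq (p s : ℝ) (hp : p ≤ 1 / 2) (hs : 0 < s) (hsp : s < p) :
    (1 - p) * (Real.log (1 + s / (1 - p)) - Real.log (1 - s / (1 - p))) ≤
      p * (Real.log (1 + s / p) - Real.log (1 - s / p)) := by
  have hp0 : 0 < p := hs.trans hsp
  have hq0 : 0 < 1 - p := by linarith
  have a1 : |s / p| < 1 := by rw [abs_of_pos (by positivity), div_lt_one hp0]; exact hsp
  have a2 : |s / (1 - p)| < 1 := by
    rw [abs_of_pos (by positivity), div_lt_one hq0]; linarith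
  have h1 := (Real.hasSum_log_sub_log_of_abs_lt_one a1).mul_left p
  have h2 := (Real.hasSum_log_sub_log_of_abs_lt_one a2).mul_left (1 - p)
  refine hasSum_le (fun i => ?_) h2 h1
  have e : ∀ r : ℝ, 0 < r → r * (2 * (1 / (2 * (i : ℝ) + 1)) * (s / r) ^ (2 * i + 1)) =
      2 * (1 / (2 * (i : ℝ) + 1)) * s * (s / r) ^ (2 * i) := by
    intro r hr
    rw [pow_succ]
    field_simp
  rw [e p hp0, e (1 - p) hq0]
  gcongr
  linarith

lemma f_ineq (k m : ℕ) (p s : ℝ) (hp : p ≤ 1 / 2) (hs : 0 < s) (hsp : s < p)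
    (hkm : (m : ℝ) * p ≤ k * (1 - p)) :
    (p - s) ^ k * (1 - (p - s)) ^ m ≤ (p + s) ^ k * (1 - (p + s)) ^ m := by
  have hp0 : 0 < p := hs.trans hsp
  have hq0 : 0 < 1 - p := by linarith
  have h := artanh_ineq p s hp hs hsp
  have b1 : 0 < p - s := by linarith
  have b2 : 0 < p + s := by linarith
  have b3 : 0 < 1 - (p - s) := by linarith
  have b4 : 0 < 1 - (p + s) := by linarith
  have e1 : Real.log (1 + s / p) - Real.log (1 - s / p) = Real.log (p + s) - Real.log (p - s) := by
    rw [show 1 + s / p = (p + s) / p by field_simp, show 1 - s / p = (p - s) / p by field_simp,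
      Real.log_div b2.ne' hp0.ne', Real.log_div b1.ne' hp0.ne']
    ring
  have e2 : Real.log (1 + s / (1 - p)) - Real.log (1 - s / (1 - p)) =
      Real.log (1 - (p - s)) - Real.log (1 - (p + s)) := by
    rw [show 1 + s / (1 - p) = (1 - (p - s)) / (1 - p) by field_simp; ring,
      show 1 - s / (1 - p) = (1 - (p + s)) / (1 - p) by field_simp; ring,
      Real.log_div b3.ne' hq0.ne', Real.log_div b4.ne' hq0.ne']
    ring
  rw [e1, e2] at h
  rw [← Real.log_le_log_iff (by positivity) (by positivity),
    Real.log_mul (by positivity) (by positivity), Real.log_mul (by positivity) (by positivity),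
    Real.log_pow, Real.log_pow, Real.log_pow, Real.log_pow]
  set U := Real.log (p + s) - Real.log (p - s) with hU
  set V := Real.log (1 - (p - s)) - Real.log (1 - (p + s)) with hV
  have hV0 : 0 ≤ V := by
    have := Real.log_le_log b4 (show 1 - (p + s) ≤ 1 - (p - s) by linarith)
    linarith
  have : (m : ℝ) * V ≤ k * U := by
    have h1 : (p * (1 - p)) * (m * V) ≤ (p * (1 - p)) * (k * U) := by
      calc (p * (1 - p)) * (m * V) = (m * p) * ((1 - p) * V) := by ring
        _ ≤ (k * (1 - p)) * (p * U) := by gcongr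
        _ = _ := by ring
    exact le_of_mul_le_mul_left h1 (by positivity)
  rw [hU, hV] at this
  linarith

noncomputable def cdfP (N k : ℕ) : Polynomial ℝ := ∑ ν ∈ range (k + 1), bernsteinPolynomial ℝ N ν

lemma cdfP_deriv (N k : ℕ) :
    Polynomial.derivative (cdfP N k) = -(N * bernsteinPolynomial ℝ (N - 1) k) := by
  induction k with
  | zero => simp [cdfP, bernsteinPolynomial.derivative_zero]
  | succ k ih =>
    unfold cdfP at *
    rw [sum_range_succ, Polynomial.derivative_add, ih, bernsteinPolynomial.derivative_succ]
    ring

lemma cdfP_zero (N k : ℕ) : (cdfP N k).eval 0 = 1 := by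
  unfold cdfP
  rw [Polynomial.eval_finsetSum]
  simp [bernsteinPolynomial.eval_at_0]

lemma cdfP_nonneg (N k : ℕ) (x : ℝ) (h0 : 0 ≤ x) (h1 : x ≤ 1) : 0 ≤ (cdfP N k).eval x := by
  unfold cdfP
  rw [Polynomial.eval_finsetSum]
  refine sum_nonneg fun i _ => ?_
  have : 0 ≤ 1 - x := by linarith
  simp [bernsteinPolynomial]
  positivity

lemma median (N k : ℕ) (hN : 0 < N) (hk : k ≤ N / 2) :
    1 / 2 ≤ (cdfP N k).eval ((k : ℝ) / N) := by
  set p : ℝ := (k : ℝ) / N with hp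
  have hN' : (0 : ℝ) < N := by exact_mod_cast hN
  have hp0 : 0 ≤ p := by positivity
  have hp2 : p ≤ 1 / 2 := by
    rw [hp, div_le_div_iff₀ hN' (by norm_num)]
    have : k * 2 ≤ 1 * N := by omega
    exact_mod_cast this
  have hkN : (k : ℝ) = N * p := by rw [hp]; field_simp
  let H : ℝ → ℝ := fun s => (cdfP N k).eval (p - s) + (cdfP N k).eval (p + s)
  let H' : ℝ → ℝ := fun s => (Polynomial.derivative (cdfP N k)).eval (p - s) * (-1) +
    (Polynomial.derivative (cdfP N k)).eval (p + s) * 1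
  have hd : ∀ s, HasDerivAt H (H' s) s := by
    intro s
    have h1 : HasDerivAt (fun s : ℝ => p - s) (-1) s := by
      simpa using (hasDerivAt_id s).const_sub p
    have h2 : HasDerivAt (fun s : ℝ => p + s) 1 s := by
      simpa using (hasDerivAt_id s).const_add p
    exact (((cdfP N k).hasDerivAt (p - s)).comp s h1).add (((cdfP N k).hasDerivAt (p + s)).comp s h2)
  have hanti : AntitoneOn H (Set.Icc 0 p) := by
    apply antitoneOn_of_hasDerivWithinAt_nonpos (convex_Icc 0 p) (f' := H')
    · exact fun s _ => (hd s).continuousAt.continuousWithinAt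
    · exact fun s _ => (hd s).hasDerivWithinAt
    · intro s hs
      rw [interior_Icc] at hs
      have hm : ((N - 1 - k : ℕ) : ℝ) * p ≤ k * (1 - p) := by
        have : ((N - 1 - k : ℕ) : ℝ) ≤ N - k := by
          have : N - 1 - k + k ≤ N := by omega
          have : ((N - 1 - k : ℕ) : ℝ) + k ≤ N := by exact_mod_cast this
          linarith
        calc _ ≤ ((N : ℝ) - k) * p := by gcongr
          _ = _ := by rw [hkN]; ring
      have := f_ineq k (N - 1 - k) p s hp2 hs.1 hs.2 hm
      simp only [H', cdfP_deriv, bernsteinPolynomial, Polynomial.eval_neg, Polynomial.eval_mul,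
        Polynomial.eval_natCast, Polynomial.eval_pow, Polynomial.eval_X, Polynomial.eval_sub,
        Polynomial.eval_one]
      have h3 := mul_le_mul_of_nonneg_left this (show (0 : ℝ) ≤ N * ((N - 1).choose k : ℝ) by positivity)
      nlinarith [h3]
  have h := hanti (Set.left_mem_Icc.2 hp0) (Set.right_mem_Icc.2 hp0) hp0
  simp only [H, sub_self, sub_zero, add_zero, cdfP_zero] at h
  have := cdfP_nonneg N k (p + p) (by linarith) (by linarith)
  linarith

/-! averaging -/

lemma wc_comp {N : ℕ} (f : Fin N → Bool) (σ : Equiv.Perm (Fin N)) : wc (f ∘ σ) = wc f := by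
  unfold wc
  exact card_equiv σ (by simp)

lemma wc_col (N k : ℕ) (hk : k ≤ N) : wc (col N k) = k := by
  unfold wc col
  simp [Fin.card_filter_val_lt, hk]

lemma exists_perm {N : ℕ} (f g : Fin N → Bool) (h : wc f = wc g) :
    ∃ τ : Equiv.Perm (Fin N), f = g ∘ τ := by
  have e : {x // f x = true} ≃ {x // g x = true} := by
    apply Fintype.equivOfCardEq
    rw [Fintype.card_subtype, Fintype.card_subtype]
    exact h
  refine ⟨e.extendSubtype, ?_⟩
  funext j
  by_cases hj : f j = true
  · have := e.extendSubtype_mem j hj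
    simp [hj, this]
  · have := e.extendSubtype_not_mem j hj
    simp at hj this
    simp [hj, this]

lemma card_wc (N k : ℕ) : (univ.filter fun f : Fin N → Bool => wc f = k).card = N.choose k := by
  have h := card_powersetCard k (univ : Finset (Fin N))
  rw [card_univ, Fintype.card_fin] at h
  rw [← h]
  refine card_bij' (fun f _ => univ.filter fun j => f j = true) (fun s _ => fun j => decide (j ∈ s)) ?_ ?_ ?_ ?_
  · intro f hf
    rw [mem_filter] at hf
    rw [mem_powersetCard]
    exact ⟨subset_univ _, hf.2⟩
  · intro s hs
    rw [mem_powersetCard] at hs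
    rw [mem_filter]
    refine ⟨mem_univ _, ?_⟩
    simpa [wc] using hs.2
  · intro f _; funext j; simp
  · intro s _; ext j; simp

/-- count of colorings with k white balls and fewer than n wb pairs -/
def B (N k n : ℕ) : ℕ := (univ.filter fun f : Fin N → Bool => wc f = k ∧ wb f < n).card

lemma eps_eq (N k n : ℕ) (hk : k ≤ N) : epsWB N k n = (B N k n : ℝ) / N.choose k := by
  have key : N.choose k * (univ.filter fun σ : Equiv.Perm (Fin N) => wbCount N k σ < n).card =
      Fintype.card (Equiv.Perm (Fin N)) * B N k n := by
    let g : (Fin N → Bool) → ℕ := fun f => if wb f < n then 1 else 0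
    have h1 : ∀ f ∈ univ.filter (fun f : Fin N → Bool => wc f = k),
        ∑ σ : Equiv.Perm (Fin N), g (f ∘ σ) =
          (univ.filter fun σ : Equiv.Perm (Fin N) => wbCount N k σ < n).card := by
      intro f hf
      obtain ⟨τ, rfl⟩ := exists_perm f (col N k) (by rw [wc_col N k hk]; simpa using hf)
      rw [card_filter]
      simp only [wbCount_eq]
      exact Equiv.sum_comp (Equiv.mulLeft τ) (fun σ : Equiv.Perm (Fin N) => g (col N k ∘ σ))
    have h2 : ∀ σ ∈ (univ : Finset (Equiv.Perm (Fin N))),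
        ∑ f ∈ univ.filter (fun f : Fin N → Bool => wc f = k), g (f ∘ σ) = B N k n := by
      intro σ _
      unfold B
      rw [← filter_filter, card_filter]
      refine sum_bij' (fun f _ => f ∘ σ) (fun f _ => f ∘ σ.symm) ?_ ?_ ?_ ?_ ?_
      · intro f hf; simpa [wc_comp] using hf
      · intro f hf; simpa [wc_comp] using hf
      · intro f _; funext j; simp
      · intro f _; funext j; simp
      · intro f _; rfl
    have h3 := sum_comm (s := univ.filter (fun f : Fin N → Bool => wc f = k))
      (t := (univ : Finset (Equiv.Perm (Fin N)))) (f := fun f σ => g (f ∘ σ))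
    rw [sum_congr rfl h1, sum_congr rfl h2, sum_const, sum_const, card_wc, card_univ] at h3
    simpa using h3
  unfold epsWB
  have c1 : (0 : ℝ) < N.choose k := by exact_mod_cast Nat.choose_pos hk
  have c2 : (0 : ℝ) < Fintype.card (Equiv.Perm (Fin N)) := by exact_mod_cast Fintype.card_pos
  rw [div_eq_div_iff c2.ne' c1.ne']
  have key' : (N.choose k : ℝ) * (univ.filter fun σ : Equiv.Perm (Fin N) => wbCount N k σ < n).card =
      Fintype.card (Equiv.Perm (Fin N)) * B N k n := by exact_mod_cast key
  linarith

lemma wb_le {N : ℕ} (f : Fin N → Bool) : wb f ≤ N := by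
  unfold wb
  refine (card_filter_le _ _).trans ?_
  simp
  omega

lemma B_eq (N k n : ℕ) : B N k n = ∑ j ∈ range n, cnt N k j := by
  unfold B
  rw [card_eq_sum_card_fiberwise (f := wb) (t := range n) (by intro f hf; simp at hf; simp [hf.2])]
  refine sum_congr rfl fun j hj => ?_
  unfold cnt
  congr 1
  ext f
  rw [mem_range] at hj
  simp only [mem_filter, mem_univ, true_and]
  constructor
  · rintro ⟨⟨a, b⟩, c⟩; exact ⟨a, c⟩
  · rintro ⟨a, c⟩; exact ⟨⟨a, by omega⟩, c⟩

lemma B_total (N k n : ℕ) (hn : N < n) : B N k n = N.choose k := by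
  rw [← card_wc]
  unfold B
  congr 1
  ext f
  have := wb_le f
  simp
  intro _
  omega

lemma B_step (N : ℕ) (hN : Even N) (k n : ℕ) (hk : k + 1 ≤ N / 2) :
    B N (k + 2) n * N.choose k ≤ B N k n * N.choose (k + 2) := by
  have t : ∀ k, N.choose k = B N k n + ∑ j ∈ Ico n (n + N + 1), cnt N k j := by
    intro k
    rw [← B_total N k (n + N + 1) (by omega), B_eq, B_eq, sum_range_add_sum_Ico _ (by omega)]
  rw [t k, t (k + 2), mul_add, mul_add, mul_comm (B N (k + 2) n) (B N k n)]
  apply Nat.add_le_add_left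
  rw [B_eq, B_eq, sum_mul_sum, sum_mul_sum]
  refine sum_le_sum fun j hj => sum_le_sum fun j' hj' => ?_
  simp at hj hj'
  rw [mul_comm (cnt N k j)]
  exact mlr N hN k hk j j' (by omega)

lemma eps_step (N : ℕ) (hN : Even N) (k n : ℕ) (hk : k + 1 ≤ N / 2) :
    epsWB N (k + 2) n ≤ epsWB N k n := by
  have : k + 2 ≤ N := by omega
  rw [eps_eq N _ n this, eps_eq N _ n (by omega)]
  have c1 : (0 : ℝ) < N.choose k := by exact_mod_cast Nat.choose_pos (by omega)
  have c2 : (0 : ℝ) < N.choose (k + 2) := by exact_mod_cast Nat.choose_pos this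
  rw [div_le_div_iff₀ c2 c1]
  exact_mod_cast B_step N hN k n hk

lemma eps_chain (N : ℕ) (hN : Even N) (k n d : ℕ) (hk : k + 2 * d ≤ N / 2) :
    epsWB N (k + 2 * d) n ≤ epsWB N k n := by
  induction d with
  | zero => simp
  | succ d ih =>
    exact (eps_step N hN (k + 2 * d) n (by omega)).trans (ih (by omega))

lemma eps_mono (N k k' n n' : ℕ) (h : ∀ σ, wbCount N k σ < n → wbCount N k' σ < n') :
    epsWB N k n ≤ epsWB N k' n' := by
  unfold epsWB
  refine div_le_div_of_nonneg_right ?_ (by positivity)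
  rw [Nat.cast_le]
  exact card_le_card (monotone_filter_right _ fun σ _ hσ => h σ hσ)

lemma wb_flip (N k : ℕ) (hk : k < N) (σ : Equiv.Perm (Fin N)) :
    wbCount N k σ ≤ wbCount N (k + 1) σ + 1 := by
  rw [wbCount_eq, wbCount_eq]
  unfold wb
  set j := σ.symm ⟨k, hk⟩ with hj
  have hjj : ∀ x, x ≠ j → col N k (σ x) = col N (k + 1) (σ x) := by
    intro x hx
    have : (σ x).1 ≠ k := by
      intro h
      apply hx
      rw [hj, Equiv.eq_symm_apply]
      exact Fin.ext h
    simp only [col, decide_eq_decide]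
    omega
  have hsub : (univ.filter fun i : Fin (N / 2) => (col N k ∘ σ) (lo i) ≠ (col N k ∘ σ) (hi i)) ⊆
      (univ.filter fun i : Fin (N / 2) => (col N (k+1) ∘ σ) (lo i) ≠ (col N (k+1) ∘ σ) (hi i)) ∪
      (univ.filter fun i : Fin (N / 2) => i.1 = j.1 / 2) := by
    intro i hi'
    simp only [mem_union, mem_filter, mem_univ, true_and, Function.comp] at hi' ⊢
    by_cases h : i.1 = j.1 / 2
    · exact Or.inr h
    · left
      rw [← hjj, ← hjj]
      · exact hi'
      · intro hh; apply h; rw [← hh]; simp only [hi]; omega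
      · intro hh; apply h; rw [← hh]; simp only [lo]; omega
  refine (card_le_card hsub).trans ((card_union_le _ _).trans ?_)
  gcongr
  rw [card_le_one]
  intro a ha b hb
  simp at ha hb
  exact Fin.ext (by omega)

lemma eps_mono' (N : ℕ) (hN : Even N) (hpos : 0 < N) (k k' n : ℕ) (hk : k ≤ N / 2) (h : k' ≤ k) :
    epsWB N k n ≤ epsWB N k' (n + 1) := by
  rcases Nat.even_or_odd' (k - k') with ⟨d, hd | hd⟩
  · obtain rfl : k = k' + 2 * d := by omega
    exact (eps_chain N hN k' n d hk).trans (eps_mono _ _ _ _ _ fun σ hσ => by omega)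
  · obtain rfl : k = (k' + 1) + 2 * d := by omega
    refine (eps_chain N hN (k' + 1) n d hk).trans (eps_mono _ _ _ _ _ fun σ hσ => ?_)
    have := wb_flip N k' (by omega) σ
    omega

lemma binom_coeff (N : ℕ) (hN : Even N) (x z : ℝ) (l : ℕ) :
    ∑ f : Fin N → Bool, (if wb f = l then x ^ wc f * z ^ (N - wc f) else 0) =
      ((N / 2).choose l : ℝ) * (2 * x * z) ^ l * (z ^ 2 + x ^ 2) ^ (N / 2 - l) := by
  open Polynomial in
  have h := congrArg (fun P : ℝ[X] => P.coeff l) (genfun (R := ℝ[X]) N hN (C x) (C z) X)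
  simp only [Polynomial.finsetSum_coeff] at h
  open Polynomial in
  have e1 : ∀ f : Fin N → Bool, (C x ^ wc f * C z ^ (N - wc f) * X ^ wb f : ℝ[X]).coeff l =
      if wb f = l then x ^ wc f * z ^ (N - wc f) else 0 := by
    intro f
    rw [← C_pow, ← C_pow, ← C_mul, coeff_C_mul, coeff_X_pow]
    simp [eq_comm]
  rw [sum_congr rfl fun f _ => e1 f] at h
  rw [h]
  open Polynomial in
  have e2 : ((C z ^ 2 + C x ^ 2 + 2 * C x * C z * X : ℝ[X])) = C (2 * x * z) * X + C (z ^ 2 + x ^ 2) := by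
    have h2 : (C (2 : ℝ)) = 2 := rfl
    simp [h2]; ring
  open Polynomial in
  have e3 : ∀ m, ((C (2 * x * z) * X) ^ m * C (z ^ 2 + x ^ 2) ^ (N / 2 - m) * ((N / 2).choose m : ℝ[X])) =
      C (((N / 2).choose m : ℝ) * (2 * x * z) ^ m * (z ^ 2 + x ^ 2) ^ (N / 2 - m)) * X ^ m := by
    intro m
    simp only [map_mul, map_pow, map_natCast, mul_pow]
    ring
  rw [e2, add_pow, Polynomial.finsetSum_coeff]
  simp only [e3, Polynomial.coeff_C_mul, Polynomial.coeff_X_pow, mul_ite, mul_one, mul_zero]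
  rw [sum_ite_eq]
  split_ifs with hl
  · rfl
  · have : (N/2).choose l = 0 := Nat.choose_eq_zero_of_lt (by simpa using hl)
    simp [this]

lemma mixture (N : ℕ) (hN : Even N) (p : ℝ) (n : ℕ) :
    ∑ l ∈ range n, ((N / 2).choose l : ℝ) * (2 * p * (1 - p)) ^ l * (1 - 2 * p * (1 - p)) ^ (N / 2 - l)
      = ∑ k ∈ range (N + 1), (B N k n : ℝ) * (p ^ k * (1 - p) ^ (N - k)) := by
  have e : 1 - 2 * p * (1 - p) = (1 - p) ^ 2 + p ^ 2 := by ring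
  rw [e]
  simp only [← binom_coeff N hN]
  rw [sum_comm]
  have wcle : ∀ f : Fin N → Bool, wc f ∈ range (N + 1) := by
    intro f
    have := card_filter_le (univ : Finset (Fin N)) (fun j => f j = true)
    simp at this
    simp [wc]; omega
  have e1 : ∀ f : Fin N → Bool, ∑ l ∈ range n, (if wb f = l then p ^ wc f * (1 - p) ^ (N - wc f) else 0)
      = ∑ k ∈ range (N + 1), if wc f = k ∧ wb f < n then p ^ k * (1 - p) ^ (N - k) else 0 := by
    intro f
    rw [sum_ite_eq]
    simp only [ite_and]
    rw [sum_ite_eq, if_pos (wcle f)]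
    simp
  rw [sum_congr rfl fun f _ => e1 f, sum_comm]
  refine sum_congr rfl fun k _ => ?_
  unfold B
  rw [← sum_filter, sum_const, nsmul_eq_mul]

end WB

/-- Paper's Result 4.1: with p_u = k/N and k ≤ N/2,
ε(n̄ | [k,N]) ≤ 2 ξ_L(n̄+1; 2p_u(1-p_u), N/2)
             = 2 Σ_{l=0}^{n̄} C(N/2,l) (2p_u(1-p_u))^l (1-2p_u(1-p_u))^(N/2-l). -/
theorem result41_wb (N k nbar : ℕ) (hN : Even N) (hNpos : 0 < N) (hk : k ≤ N / 2) :
    epsWB N k nbar ≤ 2 * ∑ l ∈ Finset.range (nbar + 1),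
      ((N / 2).choose l : ℝ) * (2 * ((k : ℝ) / N) * (1 - (k : ℝ) / N)) ^ l *
        (1 - 2 * ((k : ℝ) / N) * (1 - (k : ℝ) / N)) ^ (N / 2 - l) := by
  rw [WB.mixture N hN]
  set p : ℝ := (k : ℝ) / N with hp
  have hmed := WB.median N k hNpos hk
  rw [← hp] at hmed
  have hN' : (0 : ℝ) < N := by exact_mod_cast hNpos
  have hp0 : 0 ≤ p := by positivity
  have hp1 : 0 ≤ 1 - p := by
    have : k ≤ N := by omega
    have : (k : ℝ) ≤ N := by exact_mod_cast this
    have : p ≤ 1 := by rw [hp]; exact (div_le_one hN').2 this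
    linarith
  have heps : 0 ≤ epsWB N k nbar := by unfold epsWB; positivity
  have h1 : epsWB N k nbar * (WB.cdfP N k).eval p ≤
      ∑ k' ∈ Finset.range (k + 1), (WB.B N k' (nbar + 1) : ℝ) * (p ^ k' * (1 - p) ^ (N - k')) := by
    unfold WB.cdfP
    rw [Polynomial.eval_finsetSum, Finset.mul_sum]
    refine Finset.sum_le_sum fun k' hk' => ?_
    have hkk : k' ≤ k := by simpa [Nat.lt_succ_iff] using hk'
    have hm := WB.eps_mono' N hN hNpos k k' nbar hk hkk
    have hkN : k' ≤ N := by omega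
    rw [WB.eps_eq N k' _ hkN] at hm
    have c1 : (0 : ℝ) < N.choose k' := by exact_mod_cast Nat.choose_pos hkN
    rw [le_div_iff₀ c1] at hm
    have := mul_le_mul_of_nonneg_right hm (show 0 ≤ p ^ k' * (1 - p) ^ (N - k') by positivity)
    simp only [bernsteinPolynomial, Polynomial.eval_mul,
        Polynomial.eval_natCast, Polynomial.eval_pow, Polynomial.eval_X, Polynomial.eval_sub,
        Polynomial.eval_one]
    linarith
  have h2 : ∑ k' ∈ Finset.range (k + 1), (WB.B N k' (nbar + 1) : ℝ) * (p ^ k' * (1 - p) ^ (N - k')) ≤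
      ∑ k' ∈ Finset.range (N + 1), (WB.B N k' (nbar + 1) : ℝ) * (p ^ k' * (1 - p) ^ (N - k')) := by
    apply Finset.sum_le_sum_of_subset_of_nonneg
    · intro x hx
      simp at hx ⊢
      omega
    · intro i _ _
      positivity
  have h3 := mul_le_mul_of_nonneg_left hmed heps
  linarith
end

section
/- Let M be a positive integer and m̄ a nonnegative integer with m̄ ≤ M, and set p_e = m̄/M. Let μ be a probability measure on [0,1] (density f), and suppose a random variable X is generated by first drawing p ~ μ and then drawing X ~ Binomial(M, p). If the mixture tail satisfies ∫_0^1 f(p) · P(Binomial(M,p) ≥ m̄) dp ≤ ε for some ε ≥ 0, then μ([p_e, 1]) = ∫_{p_e}^1 f(p) dp ≤ 2ε. (Rigorous form of the paper's Eq. (eps4): the failure probability ε_4 of the bound p ≤ p_e is at most 2 ε_3; it uses that P(Binomial(M,p) ≥ m̄) is nondecreasing in p and is at least 1/2 whenever M·p ≥ m̄.) -/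
open MeasureTheory

noncomputable def binTail (M k : ℕ) (p : ℝ) : ℝ :=
  ∑ m ∈ Finset.Icc k M, (M.choose m : ℝ) * p ^ m * (1 - p) ^ (M - m)

lemma binTail_zero (M : ℕ) (p : ℝ) : binTail M 0 p = 1 := by
  have h := add_pow p (1 - p) M
  rw [show p + (1 - p) = 1 by ring, one_pow] at h
  rw [h, binTail, ← Nat.range_succ_eq_Icc_zero]
  exact Finset.sum_congr rfl (fun m _ => by ring)

lemma binTail_succ (M k : ℕ) (hk : k ≤ M) (p : ℝ) :
    binTail M k p = (M.choose k : ℝ) * p ^ k * (1 - p) ^ (M - k) + binTail M (k + 1) p := by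
  unfold binTail
  rw [← Finset.insert_Icc_add_one_left_eq_Icc hk, Finset.sum_insert (by simp)]

lemma binTail_deriv (M : ℕ) (p : ℝ) (n : ℕ) : ∀ k, k + 1 + n = M →
    HasDerivAt (binTail M (k + 1))
      ((k + 1 : ℝ) * (M.choose (k + 1)) * p ^ k * (1 - p) ^ n) p := by
  induction n with
  | zero =>
    intro k hk
    have hM : M = k + 1 := by omega
    subst hM
    have : binTail (k + 1) (k + 1) = fun p => p ^ (k + 1) := by
      funext p; simp [binTail]
    rw [this]
    have := hasDerivAt_pow (k + 1) p
    simpa using this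
  | succ n ih =>
    intro k hk
    have h1 := ih (k + 1) (by omega)
    have : binTail M (k + 1) = fun p => (M.choose (k + 1) : ℝ) * p ^ (k + 1) * (1 - p) ^ (n + 1)
        + binTail M (k + 1 + 1) p := by
      funext p
      rw [binTail_succ M (k + 1) (by omega), show M - (k + 1) = n + 1 by omega]
    rw [this]
    have hc : (M.choose (k + 1 + 1) : ℝ) * (k + 1 + 1) = M.choose (k + 1) * (n + 1) := by
      have := Nat.choose_succ_right_eq M (k + 1)
      rw [show M - (k + 1) = n + 1 by omega] at this
      exact_mod_cast this
    have hd : HasDerivAt (fun p : ℝ => (1 - p)) (-1) p := by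
      simpa using (hasDerivAt_id p).const_sub 1
    have h2 := (((hasDerivAt_pow (k + 1) p).const_mul (M.choose (k + 1) : ℝ)).mul
      (hd.pow (n + 1))).add h1
    refine HasDerivAt.congr_deriv h2 ?_
    simp only [Nat.add_sub_cancel, Pi.pow_apply]
    push_cast
    linear_combination (p ^ (k + 1) * (1 - p) ^ n) * hc

lemma binTail_mono (M k : ℕ) (hk : k ≤ M) : MonotoneOn (binTail M k) (Set.Icc 0 1) := by
  rcases k with _ | k
  · intro x _ y _ _
    simp [binTail_zero]
  · have hd := fun p => binTail_deriv M p (M - (k + 1)) k (by omega)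
    refine monotoneOn_of_hasDerivWithinAt_nonneg (convex_Icc 0 1)
      (fun x _ => (hd x).continuousAt.continuousWithinAt)
      (fun x _ => (hd x).hasDerivWithinAt) ?_
    intro x hx
    rw [interior_Icc] at hx
    have := hx.1.le
    have : 0 ≤ 1 - x := by linarith [hx.2]
    positivity

lemma log_ineq (k n a b : ℝ) (ha : 0 ≤ a) (hab : a ≤ b) (hb : b < 1) (hk : 0 ≤ k)
    (h : k * a = n * b) :
    k * (Real.log (1 + a) - Real.log (1 - a)) ≤ n * (Real.log (1 + b) - Real.log (1 - b)) := by
  have h1 := (Real.hasSum_log_sub_log_of_abs_lt_one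
    (abs_lt.2 ⟨by linarith, by linarith⟩ : |a| < 1)).mul_left k
  have h2 := (Real.hasSum_log_sub_log_of_abs_lt_one
    (abs_lt.2 ⟨by linarith, by linarith⟩ : |b| < 1)).mul_left n
  refine hasSum_le (fun i => ?_) h1 h2
  have e1 : k * (2 * (1 / (2 * (i : ℝ) + 1)) * a ^ (2 * i + 1))
    = (k * a) * (2 * (1 / (2 * (i : ℝ) + 1))) * a ^ (2 * i) := by ring
  have e2 : n * (2 * (1 / (2 * (i : ℝ) + 1)) * b ^ (2 * i + 1))
    = (k * a) * (2 * (1 / (2 * (i : ℝ) + 1))) * b ^ (2 * i) := by rw [h]; ring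
  rw [e1, e2]
  gcongr

lemma pow_ineq (k n : ℕ) (a b : ℝ) (ha : 0 ≤ a) (hab : a ≤ b) (hb : b < 1)
    (h : (k + 1 : ℝ) * a = n * b) :
    (1 + a) ^ k * (1 - b) ^ n ≤ (1 - a) ^ k * (1 + b) ^ n := by
  have a1 : 0 < 1 + a := by linarith
  have a2 : 0 < 1 - a := by linarith
  have b1 : 0 < 1 + b := by linarith
  have b2 : 0 < 1 - b := by linarith
  have h1 := log_ineq (k + 1) n a b ha hab hb (by positivity) h
  have h2 : Real.log (1 - a) ≤ Real.log (1 + a) := Real.log_le_log a2 (by linarith)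
  rw [← Real.log_le_log_iff (by positivity) (by positivity), Real.log_mul (by positivity)
    (by positivity), Real.log_mul (by positivity) (by positivity)]
  simp only [Real.log_pow]
  linarith

lemma half_large (k n : ℕ) (hn : 0 < n) (hnk : n ≤ k + 1) (p : ℝ)
    (hp : p * (k + 1 + n) = k + 1) : 1 / 2 ≤ binTail (k + 1 + n) (k + 1) p := by
  have hd := fun p => binTail_deriv (k + 1 + n) p n k rfl
  have hn' : (0 : ℝ) < n := by exact_mod_cast hn
  have hnk' : (n : ℝ) ≤ k + 1 := by exact_mod_cast hnk
  have hk0 : (0 : ℝ) ≤ k := by positivity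
  have hM : (0 : ℝ) < k + 1 + n := by positivity
  have hpe : p = (k + 1) / (k + 1 + n) := by field_simp; linarith
  have hq : (1 - p) = n / (k + 1 + n) := by rw [hpe]; field_simp; ring
  have hp0 : 0 < p := by rw [hpe]; positivity
  have hq0 : 0 < 1 - p := by rw [hq]; positivity
  have hqp : 1 - p ≤ p := by rw [hq, hpe]; gcongr
  have hdF : ∀ u : ℝ, HasDerivAt
      (fun u => binTail (k + 1 + n) (k + 1) (p + u) + binTail (k + 1 + n) (k + 1) (p - u))
      (((k + 1 : ℝ) * ((k + 1 + n).choose (k + 1)) * (p + u) ^ k * (1 - (p + u)) ^ n) -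
      ((k + 1 : ℝ) * ((k + 1 + n).choose (k + 1)) * (p - u) ^ k * (1 - (p - u)) ^ n)) u := by
    intro u
    have h1 := (hd (p + u)).comp_const_add p u
    have h2 := (hd (p - u)).comp_const_sub p u
    exact (h1.add h2)
  have hanti : AntitoneOn (fun u => binTail (k + 1 + n) (k + 1) (p + u) +
      binTail (k + 1 + n) (k + 1) (p - u)) (Set.Icc 0 (1 - p)) := by
    refine antitoneOn_of_hasDerivWithinAt_nonpos (convex_Icc _ _)
      (fun x _ => (hdF x).continuousAt.continuousWithinAt)
      (fun x _ => (hdF x).hasDerivWithinAt) ?_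
    intro u hu
    rw [interior_Icc] at hu
    obtain ⟨hu0, hu1⟩ := hu
    have key := pow_ineq k n (u / p) (u / (1 - p)) (by positivity) (by gcongr)
      (by rw [div_lt_one hq0]; exact hu1) (by rw [hq, hpe]; field_simp)
    have e1 : p + u = p * (1 + u / p) := by field_simp
    have e2 : p - u = p * (1 - u / p) := by field_simp
    have e3 : 1 - (p + u) = (1 - p) * (1 - u / (1 - p)) := by field_simp; ring
    have e4 : 1 - (p - u) = (1 - p) * (1 + u / (1 - p)) := by field_simp; ring
    rw [e3, e4, e1, e2]
    simp only [mul_pow]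
    have hC : 0 ≤ (k + 1 : ℝ) * ((k + 1 + n).choose (k + 1)) * p ^ k * (1 - p) ^ n := by
      positivity
    nlinarith [mul_le_mul_of_nonneg_left key hC]
  have h := hanti (Set.left_mem_Icc.2 hq0.le) (Set.right_mem_Icc.2 hq0.le) hq0.le
  simp only [add_zero, sub_zero] at h
  rw [show p + (1 - p) = 1 by ring] at h
  have h1 : binTail (k + 1 + n) (k + 1) 1 = 1 := by
    unfold binTail
    rw [Finset.sum_eq_single (k + 1 + n)]
    · simp
    · intro m hm hne
      rw [Finset.mem_Icc] at hm
      have : k + 1 + n - m ≠ 0 := by omega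
      simp [this]
    · intro h; simp at h
  have h0 : 0 ≤ binTail (k + 1 + n) (k + 1) (p - (1 - p)) := by
    refine Finset.sum_nonneg (fun m _ => ?_)
    have : 0 ≤ p - (1 - p) := by linarith
    have : 0 ≤ 1 - (p - (1 - p)) := by linarith
    positivity
  linarith

lemma b_rec (M m : ℕ) (hm : m < M) (p : ℝ) :
    ((M.choose (m + 1) : ℝ) * p ^ (m + 1) * (1 - p) ^ (M - (m + 1))) * ((m + 1) * (1 - p)) =
    ((M.choose m : ℝ) * p ^ m * (1 - p) ^ (M - m)) * ((M - m) * p) := by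
  have hc : (M.choose (m + 1) : ℝ) * (m + 1) = M.choose m * (M - m) := by
    have := Nat.choose_succ_right_eq M m
    rw [← Nat.cast_sub hm.le]
    exact_mod_cast this
  rw [show M - m = (M - (m + 1)) + 1 by omega, pow_succ (1 - p)]
  linear_combination (p ^ (m + 1) * (1 - p) ^ (M - (m + 1)) * (1 - p)) * hc

lemma half_small (k n : ℕ) (hkn : k ≤ n) (hk : 0 < k) (p : ℝ)
    (hp : p * (k + n) = k) : 1 / 2 ≤ binTail (k + n) k p := by
  have hk' : (0 : ℝ) < k := by exact_mod_cast hk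
  have hkn' : (k : ℝ) ≤ n := by exact_mod_cast hkn
  have hn' : (0 : ℝ) < n := by linarith
  have hM : (0 : ℝ) < k + n := by positivity
  have hpe : p = k / (k + n) := by field_simp; linarith
  have hq : (1 - p) = n / (k + n) := by rw [hpe]; field_simp; ring
  have hp0 : 0 < p := by rw [hpe]; positivity
  have hq0 : 0 < 1 - p := by rw [hq]; positivity
  set b : ℕ → ℝ := fun m => ((k + n).choose m : ℝ) * p ^ m * (1 - p) ^ (k + n - m) with hb
  have hb0 : ∀ m, 0 ≤ b m := fun m => by simp only [hb]; positivity
  have hrec : ∀ m, m < k + n → b (m + 1) * ((m + 1) * n) = b m * ((k + n - m) * k) := by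
    intro m hm
    have h := b_rec (k + n) m hm p
    have e1 : (n : ℝ) = (1 - p) * (k + n) := by rw [hq]; field_simp
    have h' : b (m + 1) * ((m + 1) * (1 - p)) = b m * ((k + n - m) * p) := by
      simp only [hb]; push_cast at h; exact h
    calc b (m + 1) * ((m + 1) * n) = b (m + 1) * ((m + 1) * (1 - p)) * (k + n) := by
          linear_combination (b (m + 1) * (m + 1)) * e1
      _ = b m * ((k + n - m) * (p * (k + n))) := by rw [h']; ring
      _ = _ := by rw [hp]
  have hpair : ∀ j, j < k → b (k - 1 - j) ≤ b (k + j) := by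
    intro j
    induction j with
    | zero =>
      intro _
      obtain ⟨k', rfl⟩ : ∃ k', k = k' + 1 := ⟨k - 1, by omega⟩
      have h := hrec k' (by omega)
      simp only [Nat.add_sub_cancel, Nat.sub_zero, add_zero]
      push_cast at h hk'
      have := hb0 k'
      have hpos : (0 : ℝ) < (k' + 1) * n := by positivity
      refine le_of_mul_le_mul_right ?_ hpos
      rw [h]
      refine mul_le_mul_of_nonneg_left ?_ this
      nlinarith
    | succ j ih =>
      intro hj
      have ih := ih (by omega)
      obtain ⟨i, hi⟩ : ∃ i, k = j + 2 + i := ⟨k - (j + 2), by omega⟩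
      have hA := hrec (k + j) (by omega)
      have hB := hrec i (by omega)
      rw [show k - 1 - j = i + 1 by omega] at ih
      rw [show k - 1 - (j + 1) = i by omega, ← add_assoc]
      have hir : (k : ℝ) = j + 2 + i := by exact_mod_cast hi
      push_cast at hA
      have hj0 : (0 : ℝ) ≤ j := by positivity
      have hi0 : (0 : ℝ) ≤ i := by positivity
      have hpos : (0 : ℝ) < ((k + j + 1) * n) * ((i + 1) * n) := by positivity
      refine le_of_mul_le_mul_right ?_ hpos
      have hnj : (0 : ℝ) ≤ n - j := by linarith
      have hie : (i : ℝ) = k - j - 2 := by linarith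
      calc b i * (((k + j + 1) * n) * ((i + 1) * n))
          ≤ b i * (((k + n - i) * k) * ((n - j) * k)) := by
            refine mul_le_mul_of_nonneg_left ?_ (hb0 i)
            rw [hie]
            have hs : 0 ≤ ((j : ℝ) * (j + 2)) * ((n - k) * (n + k)) := by
              have : (0 : ℝ) ≤ n - k := by linarith
              positivity
            have h2 : 0 ≤ 2 * (n : ℝ) * k ^ 2 + n ^ 2 := by positivity
            nlinarith
        _ = b (i + 1) * ((i + 1) * n) * ((n - j) * k) := by rw [hB]; ring
        _ ≤ b (k + j) * ((i + 1) * n) * ((n - j) * k) := by gcongr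
        _ = b (k + j + 1) * (((k + j + 1) * n) * ((i + 1) * n)) := by
            linear_combination (-((i + 1) * (n : ℝ))) * hA
  have htot : ∑ m ∈ Finset.range (k + n + 1), b m = 1 := by
    have := binTail_zero (k + n) p
    rw [binTail, ← Nat.range_succ_eq_Icc_zero] at this
    exact this
  have hT : binTail (k + n) k p = ∑ j ∈ Finset.range (n + 1), b (k + j) := by
    unfold binTail
    rw [← Finset.Ico_add_one_right_eq_Icc, Finset.sum_Ico_eq_sum_range]
    rw [show k + n + 1 - k = n + 1 by omega]
  rw [add_assoc, Finset.sum_range_add, ← hT] at htot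
  have hL : ∑ m ∈ Finset.range k, b m ≤ binTail (k + n) k p := by
    rw [← Finset.sum_range_reflect, hT]
    calc _ ≤ ∑ j ∈ Finset.range k, b (k + j) :=
          Finset.sum_le_sum (fun j hj => hpair j (Finset.mem_range.1 hj))
      _ ≤ _ := Finset.sum_le_sum_of_subset_of_nonneg
          (Finset.range_mono (by omega)) (fun _ _ _ => hb0 _)
  linarith

lemma half_le (M k : ℕ) (hM : 0 < M) (hk : k ≤ M) :
    1 / 2 ≤ binTail M k ((k : ℝ) / M) := by
  have hM' : (0 : ℝ) < M := by exact_mod_cast hM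
  obtain ⟨n, rfl⟩ := Nat.exists_eq_add_of_le hk
  rcases k with _ | k
  · rw [binTail_zero]; norm_num
  have hp : ((k + 1 : ℕ) : ℝ) / ((k + 1 + n : ℕ) : ℝ) * (((k + 1 : ℕ) : ℝ) + n) = (k + 1 : ℕ) := by
    push_cast at hM' ⊢
    field_simp
  rcases Nat.eq_zero_or_pos n with rfl | hn
  · have : ((k + 1 : ℕ) : ℝ) / ((k + 1 + 0 : ℕ) : ℝ) = 1 := by
      rw [add_zero]; exact div_self (by positivity)
    rw [this]
    simp [binTail]
    norm_num
  rcases le_total (k + 1) n with h | h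
  · exact half_small (k + 1) n h (by omega) _ hp
  · exact half_large k n hn h _ (by push_cast at hp ⊢; exact hp)

/-- Rigorous form of the paper's Eq. (eps4): let `μ` be a probability measure on [0,1]
(the mixing distribution over the Bernoulli parameter `p`), `m̄ ≤ M`, `p_e = m̄/M`.
If the mixture tail probability `∫ P(Binomial(M,p) ≥ m̄) dμ(p)` is at most `ε`,
then `μ([p_e, 1]) ≤ 2ε`. -/
theorem eps4_bound (M mbar : ℕ) (hM : 0 < M) (hmbar : mbar ≤ M)
    (μ : Measure ℝ) [IsProbabilityMeasure μ]
    (hsupp : μ (Set.Icc (0 : ℝ) 1)ᶜ = 0)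
    (pe : ℝ) (hpe : pe = (mbar : ℝ) / M)
    (ε : ℝ) (hε : 0 ≤ ε)
    (htail : ∫⁻ p, ENNReal.ofReal (∑ m ∈ Finset.Icc mbar M,
        (M.choose m : ℝ) * p ^ m * (1 - p) ^ (M - m)) ∂μ ≤ ENNReal.ofReal ε) :
    μ (Set.Icc pe 1) ≤ ENNReal.ofReal (2 * ε) := by
  have hpe0 : 0 ≤ pe := by rw [hpe]; positivity
  have hpe1 : pe ≤ 1 := by
    rw [hpe]; exact div_le_one_of_le₀ (by exact_mod_cast hmbar) (by positivity)
  have h1 : ∀ p ∈ Set.Icc pe 1, ENNReal.ofReal (1 / 2) ≤ ENNReal.ofReal (binTail M mbar p) := by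
    intro p hp
    apply ENNReal.ofReal_le_ofReal
    refine (half_le M mbar hM hmbar).trans ?_
    rw [← hpe]
    exact binTail_mono M mbar hmbar ⟨hpe0, hpe1⟩ ⟨hpe0.trans hp.1, hp.2⟩ hp.1
  have h2 : ENNReal.ofReal (1 / 2) * μ (Set.Icc pe 1) ≤ ENNReal.ofReal ε := by
    calc _ = ∫⁻ p in Set.Icc pe 1, ENNReal.ofReal (1 / 2) ∂μ := by
          rw [setLIntegral_const]
      _ ≤ ∫⁻ p in Set.Icc pe 1, ENNReal.ofReal (binTail M mbar p) ∂μ :=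
          setLIntegral_mono' measurableSet_Icc h1
      _ ≤ ∫⁻ p, ENNReal.ofReal (binTail M mbar p) ∂μ := setLIntegral_le_lintegral _ _
      _ ≤ _ := htail
  calc μ (Set.Icc pe 1) = ENNReal.ofReal 2 * (ENNReal.ofReal (1 / 2) * μ (Set.Icc pe 1)) := by
        rw [← mul_assoc, ← ENNReal.ofReal_mul (by norm_num)]; norm_num
    _ ≤ ENNReal.ofReal 2 * ENNReal.ofReal ε := by gcongr
    _ = _ := by rw [← ENNReal.ofReal_mul (by norm_num)]
end
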